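/- Let d ≥ 2 and K ≥ 2, let V : Fin K → (Fin d → ℝ) and a : Fin K → ℝ, and define the affine classifier f r z = (∑ i, V r i * z i) + a r for r : Fin K. Let ε₁, ε_∞ > 0 with ε_∞ < ε₁ < d·ε_∞, let p ∈ (1, ∞) with Hölder conjugate q (1/p + 1/q = 1), and set α = ε₁/ε_∞ − ⌊ε₁/ε_∞⌋. Fix x : Fin d → ℝ and c : Fin K. If f c (x + δ) ≥ f s (x + δ) for every s : Fin K and every δ with ‖δ‖₁ ≤ ε₁, and also for every δ with ‖δ‖_∞ ≤ ε_∞, then f c (x + δ) ≥ f s (x + δ) for every s : Fin K and every δ with ‖δ‖_p ≤ ε₁ / (ε₁/ε_∞ − α + α^q)^(1/q). -/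

import Mathlib

open Finset

noncomputable def lpnorm {d : ℕ} (p : ℝ) (x : Fin d → ℝ) : ℝ :=
  (∑ i, |x i| ^ p) ^ (1 / p)

noncomputable def l1norm {d : ℕ} (x : Fin d → ℝ) : ℝ := ∑ i, |x i|

noncomputable def linfnorm {d : ℕ} (x : Fin d → ℝ) : ℝ := ⨆ i, |x i|

theorem aux_convex (q : ℝ) (hq : 1 ≤ q) (u a t : ℝ) (hu : 0 ≤ u) (hu1 : u < 1) (ha : a ≤ 1)
    (ht : t ≤ 1) (h : a + t = 1 + u) : a ^ q + t ^ q ≤ 1 + u ^ q := by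
  have hc := convexOn_rpow hq
  have h1u : 0 < 1 - u := by linarith
  obtain ⟨l, hl⟩ : ∃ l, l = (1 - a) / (1 - u) := ⟨_, rfl⟩
  have hl' : l * (1 - u) = 1 - a := by rw [hl]; field_simp
  have hl0 : 0 ≤ l := by rw [hl]; exact div_nonneg (by linarith) h1u.le
  have hl1 : l ≤ 1 := by rw [hl, div_le_one h1u]; linarith
  have A := hc.2 (x := u) (y := 1) hu (Set.mem_Ici.2 zero_le_one) hl0 (sub_nonneg.2 hl1) (by ring)
  have B := hc.2 (x := 1) (y := u) (Set.mem_Ici.2 zero_le_one) hu hl0 (sub_nonneg.2 hl1) (by ring)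
  simp only [smul_eq_mul, Real.one_rpow] at A B
  have e1 : l * u + (1 - l) * 1 = a := by linarith
  have e2 : l * 1 + (1 - l) * u = t := by linarith
  rw [e1] at A
  rw [e2] at B
  linarith

noncomputable def auxF (q S : ℝ) : ℝ := ⌊S⌋ + (Int.fract S) ^ q

theorem auxF_mono (q : ℝ) (hq : 1 ≤ q) {S T : ℝ} (h : S ≤ T) : auxF q S ≤ auxF q T := by
  unfold auxF
  have h0 := Int.fract_nonneg S
  have h0' := Int.fract_nonneg T
  rcases (Int.floor_le_floor h).eq_or_lt with e | e
  · have : Int.fract S ≤ Int.fract T := by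
      unfold Int.fract; rw [e]; linarith
    have := Real.rpow_le_rpow h0 this (by linarith : 0 ≤ q)
    rw [e]; linarith
  · have h3 : ((⌊S⌋ : ℤ) : ℝ) + 1 ≤ ⌊T⌋ := by exact_mod_cast e
    have := Real.rpow_le_one h0 (Int.fract_lt_one S).le (by linarith : 0 ≤ q)
    have := Real.rpow_nonneg h0' q
    linarith

theorem auxF_add (q : ℝ) (hq : 1 ≤ q) (S t : ℝ) (ht0 : 0 ≤ t) (ht1 : t ≤ 1) :
    auxF q S + t ^ q ≤ auxF q (S + t) := by
  have h0 := Int.fract_nonneg S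
  have h1 := Int.fract_lt_one S
  have hS := Int.floor_add_fract S
  by_cases hc : Int.fract S + t < 1
  · have hfl : ⌊S + t⌋ = ⌊S⌋ := by
      rw [Int.floor_eq_iff]; constructor <;> linarith
    have hfr : Int.fract (S + t) = Int.fract S + t := by
      unfold Int.fract; rw [hfl]; ring
    unfold auxF
    rw [hfl, hfr]
    have := Real.add_rpow_le_rpow_add h0 ht0 hq
    linarith
  · push Not at hc
    have hfl : ⌊S + t⌋ = ⌊S⌋ + 1 := by
      rw [Int.floor_eq_iff]; push_cast; constructor <;> linarith
    have hfr : Int.fract (S + t) = Int.fract S + t - 1 := by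
      unfold Int.fract; rw [hfl]; push_cast; ring
    unfold auxF
    rw [hfl, hfr]
    have := aux_convex q hq (Int.fract S + t - 1) (Int.fract S) t (by linarith) (by linarith)
      h1.le ht1 (by ring)
    push_cast
    linarith

theorem auxF_sum (q : ℝ) (hq : 1 ≤ q) {ι : Type*} (s : Finset ι) (t : ι → ℝ)
    (h0 : ∀ i, 0 ≤ t i) (h1 : ∀ i, t i ≤ 1) : ∑ i ∈ s, t i ^ q ≤ auxF q (∑ i ∈ s, t i) := by
  classical
  induction s using Finset.induction_on with
  | empty =>
    have : (0 : ℝ) ^ q = 0 := Real.zero_rpow (by linarith)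
    simp [auxF, this]
  | insert i s hi ih =>
    rw [Finset.sum_insert hi, Finset.sum_insert hi]
    have := auxF_add q hq (∑ i ∈ s, t i) (t i) (h0 i) (h1 i)
    rw [add_comm (t i) (∑ i ∈ s, t i)]
    linarith

theorem affine_classifier_union_to_lp
    (d K : ℕ) (hd : 2 ≤ d) (hK : 2 ≤ K)
    (V : Fin K → Fin d → ℝ) (a : Fin K → ℝ)
    (f : Fin K → (Fin d → ℝ) → ℝ)
    (hf : ∀ r z, f r z = (∑ i, V r i * z i) + a r)
    (ε1 εinf : ℝ) (hε1 : 0 < ε1) (hεinf : 0 < εinf)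
    (h1 : εinf < ε1) (h2 : ε1 < d * εinf)
    (p q : ℝ) (hp : 1 < p) (hpq : 1 / p + 1 / q = 1)
    (α : ℝ) (hα : α = ε1 / εinf - ⌊ε1 / εinf⌋)
    (x : Fin d → ℝ) (c : Fin K)
    (hrob1 : ∀ δ : Fin d → ℝ, l1norm δ ≤ ε1 →
      ∀ s : Fin K, f c (x + δ) ≥ f s (x + δ))
    (hrobinf : ∀ δ : Fin d → ℝ, linfnorm δ ≤ εinf →
      ∀ s : Fin K, f c (x + δ) ≥ f s (x + δ)) :
    ∀ δ : Fin d → ℝ, lpnorm p δ ≤ ε1 / (ε1 / εinf - α + α ^ q) ^ (1 / q) →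
      ∀ s : Fin K, f c (x + δ) ≥ f s (x + δ) := by
  intro δ hδ s
  have hd0 : 0 < d := by omega
  haveI : Nonempty (Fin d) := ⟨⟨0, hd0⟩⟩
  have hpq' : p.HolderConjugate q := by
    rw [Real.holderConjugate_iff]
    exact ⟨hp, by simpa [one_div] using hpq⟩
  have hq : 1 < q := hpq'.symm.lt
  have hp0 : 0 < p := by linarith
  have hq0 : 0 < q := by linarith
  obtain ⟨w, hw⟩ : ∃ w : Fin d → ℝ, w = fun i => V c i - V s i := ⟨_, rfl⟩
  obtain ⟨b, hb⟩ : ∃ b : ℝ, b = f c x - f s x := ⟨_, rfl⟩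
  have key : ∀ δ : Fin d → ℝ, f c (x + δ) - f s (x + δ) = b + ∑ i, w i * δ i := by
    intro δ
    rw [hb, hw]
    simp only [hf, Pi.add_apply, mul_add, sub_mul, Finset.sum_add_distrib, Finset.sum_sub_distrib]
    ring
  have hsgn : ∀ y : ℝ, y * SignType.sign y = |y| := fun y => self_mul_sign y
  have hsgn1 : ∀ y : ℝ, |((SignType.sign y : SignType) : ℝ)| ≤ 1 := by
    intro y
    rcases lt_trichotomy y 0 with h | h | h <;> simp [h]
  -- l_infinity consequence
  have hI : εinf * ∑ i, |w i| ≤ b := by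
    have h := hrobinf (fun i => -(εinf * SignType.sign (w i))) (by
      unfold linfnorm
      apply ciSup_le
      intro i
      rw [abs_neg, abs_mul, abs_of_pos hεinf]
      exact mul_le_of_le_one_right hεinf.le (hsgn1 _)) s
    have h' := key (fun i => -(εinf * SignType.sign (w i)))
    have e : ∑ i, w i * (-(εinf * SignType.sign (w i))) = -(εinf * ∑ i, |w i|) := by
      rw [Finset.mul_sum, ← Finset.sum_neg_distrib]
      refine Finset.sum_congr rfl fun i _ => ?_
      rw [← hsgn (w i)]; ring
    rw [e] at h'
    linarith
  have h1' : ∀ j, ε1 * |w j| ≤ b := by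
    intro j
    have h := hrob1 (Pi.single j (-(ε1 * SignType.sign (w j)))) (by
      unfold l1norm
      rw [Finset.sum_eq_single j]
      · rw [Pi.single_eq_same, abs_neg, abs_mul, abs_of_pos hε1]
        exact mul_le_of_le_one_right hε1.le (hsgn1 _)
      · intro i _ hij
        simp [hij]
      · simp) s
    have h' := key (Pi.single j (-(ε1 * SignType.sign (w j))))
    have e : ∑ i, w i * (Pi.single j (-(ε1 * SignType.sign (w j))) : Fin d → ℝ) i
        = -(ε1 * |w j|) := by
      rw [Finset.sum_eq_single j]
      · rw [Pi.single_eq_same, ← hsgn (w j)]; ring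
      · intro i _ hij
        simp [hij]
      · simp
    rw [e] at h'
    linarith
  have hb0 : 0 ≤ b := le_trans (mul_nonneg hε1.le (abs_nonneg _)) (h1' ⟨0, hd0⟩)
  have goal' : -(∑ i, w i * δ i) ≤ b := by
    rcases hb0.eq_or_lt with h0 | hbpos
    · have hw0 : ∀ i, w i = 0 := by
        intro i
        have := h1' i
        rw [← h0] at this
        have h3 : |w i| ≤ 0 := by
          by_contra hcon
          push Not at hcon
          have := mul_pos hε1 hcon
          linarith
        exact abs_nonpos_iff.1 h3
      simp [hw0, hb0]
    obtain ⟨G, hG⟩ : ∃ G, G = ε1 / εinf - α + α ^ q := ⟨_, rfl⟩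
    have hGF : G = auxF q (ε1 / εinf) := by
      have : α = Int.fract (ε1 / εinf) := by rw [hα]; rfl
      rw [hG, this, auxF, Int.self_sub_fract]
    have hG0 : 0 < G := by
      rw [hGF, auxF]
      have h3 : (1 : ℤ) ≤ ⌊ε1 / εinf⌋ := by
        rw [Int.le_floor]; push_cast
        rw [le_div_iff₀ hεinf]; linarith
      have h4 : (1 : ℝ) ≤ ⌊ε1 / εinf⌋ := by exact_mod_cast h3
      have := Real.rpow_nonneg (Int.fract_nonneg (ε1 / εinf)) q
      linarith
    have hsum : ∑ i, (ε1 / b * |w i|) ^ q ≤ G := by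
      rw [hGF]
      refine (auxF_sum q hq.le Finset.univ (fun i => ε1 / b * |w i|) ?_ ?_).trans
        (auxF_mono q hq.le ?_)
      · intro i; positivity
      · intro i
        have := h1' i
        rw [div_mul_eq_mul_div, div_le_one hbpos]; exact this
      · rw [← Finset.mul_sum, div_mul_eq_mul_div, div_le_div_iff₀ hbpos hεinf]
        nlinarith
    have hol := Real.inner_le_Lp_mul_Lq Finset.univ δ (fun i => -(ε1 / b * w i)) hpq'
    have e1 : ∑ i, |(-(ε1 / b * w i))| ^ q = ∑ i, (ε1 / b * |w i|) ^ q := by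
      refine Finset.sum_congr rfl fun i _ => ?_
      rw [abs_neg, abs_mul, abs_of_pos (div_pos hε1 hbpos)]
    have e2 : ∑ i, δ i * (-(ε1 / b * w i)) = ε1 / b * (-(∑ i, w i * δ i)) := by
      rw [← Finset.sum_neg_distrib, Finset.mul_sum]
      refine Finset.sum_congr rfl fun i _ => ?_
      ring
    rw [e1, e2] at hol
    have hGq : 0 < G ^ (1 / q) := Real.rpow_pos_of_pos hG0 _
    have hA : (∑ i, (ε1 / b * |w i|) ^ q) ^ (1 / q) ≤ G ^ (1 / q) := by
      apply Real.rpow_le_rpow _ hsum (by positivity)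
      exact Finset.sum_nonneg fun i _ => by positivity
    rw [← hG] at hδ
    unfold lpnorm at hδ
    have hfin : ε1 / b * (-(∑ i, w i * δ i)) ≤ ε1 := by
      refine hol.trans ((mul_le_mul hδ hA ?_ (by positivity)).trans ?_)
      · exact Real.rpow_nonneg (Finset.sum_nonneg fun i _ => by positivity) _
      · rw [div_mul_cancel₀ _ hGq.ne']
    rw [div_mul_eq_mul_div, div_le_iff₀ hbpos] at hfin
    exact le_of_mul_le_mul_left hfin hε1
  have := key δ
  linarith
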